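/- Let n ≥ 3 and let H be a group that contains Aut(F_n), i.e., there exists an injective group homomorphism Aut(F_n) → H. Then H is nonlinear: for every field K and every natural number m, there is no injective group homomorphism H → GL(m, K). -/

import Mathlib

section
open Module

theorem fp_det_blockDiagonal' {R ι : Type*} [CommRing R] [Fintype ι] [DecidableEq ι]
    {κ : ι → Type*} [∀ i, Fintype (κ i)] [∀ i, DecidableEq (κ i)]
    (M : ∀ i, Matrix (κ i) (κ i) R) :
    (Matrix.blockDiagonal' M).det = ∏ i, (M i).det := by
  classical
  let e := Fintype.equivFin ι
  let _ : LinearOrder ι := LinearOrder.lift' e e.injective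
  have hb : (Matrix.blockDiagonal' M).BlockTriangular Sigma.fst :=
    Matrix.blockTriangular_blockDiagonal' M
  rw [hb.det_fintype]
  refine Finset.prod_congr rfl fun k _ => ?_
  let e' : {a : Sigma κ // a.1 = k} ≃ κ k := Equiv.sigmaSubtype k
  rw [← Matrix.det_submatrix_equiv_self e'.symm]
  congr 1
  ext i j
  simp [e', Matrix.toSquareBlock, Matrix.toSquareBlockProp, Equiv.sigmaSubtype]

theorem fp_det_internal {K V ι : Type*} [Field K] [AddCommGroup V] [Module K V]
    [FiniteDimensional K V] [Fintype ι] [DecidableEq ι] {N : ι → Submodule K V}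
    (h : DirectSum.IsInternal N) {f : V →ₗ[K] V} (hf : ∀ i, Set.MapsTo f (N i) (N i)) :
    f.det = ∏ i, (f.restrict (hf i)).det := by
  classical
  let b : (i : ι) → Basis _ K (N i) := fun i ↦ Module.Free.chooseBasis K (N i)
  simp_rw [← LinearMap.det_toMatrix (h.collectedBasis b),
    LinearMap.toMatrix_directSum_collectedBasis_eq_blockDiagonal' h h b b hf,
    fp_det_blockDiagonal', LinearMap.det_toMatrix]

theorem fp_charpoly_internal {K V ι : Type*} [Field K] [Infinite K] [AddCommGroup V] [Module K V]
    [FiniteDimensional K V] [Fintype ι] [DecidableEq ι] {N : ι → Submodule K V}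
    (h : DirectSum.IsInternal N) {f : V →ₗ[K] V} (hf : ∀ i, Set.MapsTo f (N i) (N i)) :
    f.charpoly = ∏ i, (f.restrict (hf i)).charpoly := by
  refine Polynomial.funext fun t => ?_
  rw [Polynomial.eval_prod]
  simp_rw [LinearMap.eval_charpoly]
  have hf' : ∀ i, Set.MapsTo (algebraMap K (End K V) t - f) (N i) (N i) := fun i v hv => by
    simpa using (N i).sub_mem ((N i).smul_mem t hv) (hf i hv)
  rw [fp_det_internal h hf']
  rfl

theorem fp_charpoly_add_nil {K V : Type*} [Field K] [Infinite K] [AddCommGroup V] [Module K V]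
    [FiniteDimensional K V] {f n : End K V} (hc : Commute f n) (hn : IsNilpotent n) :
    (f + n).charpoly = f.charpoly := by
  refine Polynomial.eq_of_infinite_eval_eq _ _ ?_
  have hfin : {t | f.charpoly.eval t = 0}.Finite := by
    classical
    have := (f.charpoly.roots.toFinset).finite_toSet
    refine this.subset fun t ht => ?_
    simp only [Finset.mem_coe, Multiset.mem_toFinset]
    exact (Polynomial.mem_roots f.charpoly_monic.ne_zero).2 ht
  refine (hfin.infinite_compl).mono fun t ht => ?_
  simp only [Set.mem_compl_iff, Set.mem_ofPred_eq] at ht ⊢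
  rw [LinearMap.eval_charpoly] at ht
  rw [LinearMap.eval_charpoly, LinearMap.eval_charpoly]
  set s := algebraMap K (End K V) t - f with hs
  have hu : IsUnit s := (LinearMap.isUnit_iff_isUnit_det _).2 (isUnit_iff_ne_zero.2 ht)
  obtain ⟨u, hu⟩ := hu
  have hcs : Commute s n := Commute.sub_left (Algebra.commutes t n) hc
  have hcu : Commute (↑u⁻¹ : End K V) n := by
    rw [← hu] at hcs; exact hcs.units_inv_left
  have h1 : algebraMap K (End K V) t - (f + n) = s * (1 - ↑u⁻¹ * n) := by
    rw [mul_sub, ← mul_assoc, ← hu, Units.mul_inv, hu, hs]; simp; abel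
  have hnil : IsNilpotent ((↑u⁻¹ : End K V) * n) := hcu.isNilpotent_mul_left hn
  have h2 := hnil.charpoly_eq_X_pow_finrank
  have h3 : LinearMap.det (1 - (↑u⁻¹ : End K V) * n) = 1 := by
    have := LinearMap.eval_charpoly ((↑u⁻¹ : End K V) * n) 1
    rw [h2] at this
    simpa using this.symm
  rw [h1, map_mul, h3, mul_one]

open Classical in
/-- joint eigenvalue data. -/
theorem fp_joint {K V : Type*} [Field K] [IsAlgClosed K] [AddCommGroup V] [Module K V]
    [FiniteDimensional K V] (A B : End K V) (hAB : Commute B A)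
    (hdet : ∀ c, (A.restrict (B.mapsTo_maxGenEigenspace_of_comm hAB c)).det = 1) :
    ∃ P : Multiset (K × K), A.charpoly.roots = P.map Prod.fst ∧
      B.charpoly.roots = P.map Prod.snd ∧
      (A * B).charpoly.roots = P.map (fun p => p.1 * p.2) ∧
      ∀ c, ((P.filter (fun p => p.2 = c)).map Prod.fst).prod = 1 := by
  classical
  have hfin : {c | B.maxGenEigenspace c ≠ ⊥}.Finite :=
    WellFoundedGT.finite_ne_bot_of_iSupIndep B.independent_maxGenEigenspace
  let _ : Fintype {c | B.maxGenEigenspace c ≠ ⊥} := hfin.fintype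
  let _ : Fintype {c // B.maxGenEigenspace c ≠ ⊥} := hfin.fintype
  have hint0 : DirectSum.IsInternal (fun c => B.maxGenEigenspace c) :=
    DirectSum.isInternal_submodule_of_iSupIndep_of_iSup_eq_top B.independent_maxGenEigenspace
      (Module.End.iSup_maxGenEigenspace_eq_top B)
  have hint := DirectSum.isInternal_ne_bot_iff.mpr hint0
  have hA := fun c => B.mapsTo_maxGenEigenspace_of_comm hAB c
  have hB := fun c => B.mapsTo_maxGenEigenspace_of_comm (Commute.refl B) c
  have hABm : ∀ c, Set.MapsTo (A * B) (B.maxGenEigenspace c) (B.maxGenEigenspace c) :=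
    fun c => (hA c).comp (hB c)
  let S : K → Multiset K := fun c => (A.restrict (hA c)).charpoly.roots
  have hSplit : ∀ p : Polynomial K, p.Monic → p = (p.roots.map (fun a => Polynomial.X - Polynomial.C a)).prod :=
    fun p hp => (IsAlgClosed.splits p).eq_prod_roots_of_monic hp
  have hcA : ∀ c, (A.restrict (hA c)).charpoly = ((S c).map (fun a => Polynomial.X - Polynomial.C a)).prod :=
    fun c => hSplit _ (LinearMap.charpoly_monic _)
  have hcard : ∀ c, (S c).card = finrank K (B.maxGenEigenspace c) := fun c => by
    rw [← (A.restrict (hA c)).charpoly_natDegree]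
    exact ((IsAlgClosed.splits _).natDegree_eq_card_roots).symm
  have hnil : ∀ c, IsNilpotent (B.restrict (hB c) - algebraMap K _ c) := fun c =>
    B.isNilpotent_restrict_maxGenEigenspace_sub_algebraMap c
  have hcB : ∀ c, (B.restrict (hB c)).charpoly = ((S c).map (fun a => Polynomial.X - Polynomial.C c)).prod := by
    intro c
    have h1 := fp_charpoly_add_nil (f := algebraMap K _ c) (Algebra.commutes c _) (hnil c)
    rw [add_sub_cancel] at h1
    rw [h1]
    have h2 := LinearMap.charpoly_sub_smul (0 : End K (B.maxGenEigenspace c)) (-c)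
    rw [Multiset.map_const', Multiset.prod_replicate, hcard]
    have h3 : (0 : End K (B.maxGenEigenspace c)) - (-c) • 1 = algebraMap K _ c := by
      ext v; simp
    rw [h3] at h2
    rw [h2]; simp [sub_eq_add_neg]
  have hcAB : ∀ c, ((A * B).restrict (hABm c)).charpoly = ((S c).map (fun a => Polynomial.X - Polynomial.C (a * c))).prod := by
    intro c
    have hcomm : Commute (A.restrict (hA c)) (B.restrict (hB c)) := by
      refine LinearMap.ext fun v => Subtype.ext ?_
      exact LinearMap.congr_fun hAB.symm.eq (v : V)
    have hcomm2 : Commute (A.restrict (hA c)) (B.restrict (hB c) - algebraMap K _ c) :=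
      Commute.sub_right hcomm (Algebra.commutes c _).symm
    have e1 : (A * B).restrict (hABm c) = c • A.restrict (hA c) +
        A.restrict (hA c) * (B.restrict (hB c) - algebraMap K _ c) := by
      rw [mul_sub]
      have : (A * B).restrict (hABm c) = A.restrict (hA c) * B.restrict (hB c) := rfl
      rw [this, ← Algebra.commutes, Algebra.smul_def]; abel
    rw [e1, fp_charpoly_add_nil]
    · refine Polynomial.funext fun t => ?_
      rw [LinearMap.eval_charpoly, Polynomial.eval_multiset_prod, Multiset.map_map]
      simp only [Function.comp_def, Polynomial.eval_sub, Polynomial.eval_X, Polynomial.eval_C]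
      rcases eq_or_ne c 0 with rfl | hc
      · simp [hcard, Algebra.algebraMap_eq_smul_one]
      · have h1 : algebraMap K (End K (B.maxGenEigenspace c)) t - c • A.restrict (hA c) =
            c • (algebraMap K (End K (B.maxGenEigenspace c)) (t / c) - A.restrict (hA c)) := by
          rw [smul_sub, Algebra.algebraMap_eq_smul_one, Algebra.algebraMap_eq_smul_one, smul_smul,
            mul_div_cancel₀ _ hc]
        rw [h1, LinearMap.det_smul, ← LinearMap.eval_charpoly, hcA, Polynomial.eval_multiset_prod,
          Multiset.map_map, ← hcard, ← Multiset.prod_replicate,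
          ← Multiset.map_const', ← Multiset.prod_map_mul]
        congr 1
        refine Multiset.map_congr rfl fun a _ => ?_
        simp only [Function.comp_def, Polynomial.eval_sub, Polynomial.eval_X, Polynomial.eval_C]
        field_simp
    · exact ((Commute.refl _).mul_right hcomm2).smul_left c
    · exact hcomm2.isNilpotent_mul_left (hnil c)
  have key : ∀ (f : End K V) (hf : ∀ c, Set.MapsTo f (B.maxGenEigenspace c) (B.maxGenEigenspace c))
      (F : K × K → K) (_ : ∀ c, (f.restrict (hf c)).charpoly =
        ((S c).map (fun a => Polynomial.X - Polynomial.C (F (a, c)))).prod),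
      f.charpoly.roots =
        (∑ c : {c // B.maxGenEigenspace c ≠ ⊥}, (S c).map (fun a => (a, (c : K)))).map F := by
    intro f hf F hF
    rw [fp_charpoly_internal hint (fun i => hf i)]
    simp_rw [hF]
    rw [← Polynomial.roots_multiset_prod_X_sub_C (Multiset.map F _), Multiset.map_map]
    congr 1
    rw [← Multiset.coe_mapAddMonoidHom, map_sum, Multiset.prod_sum]
    refine Finset.prod_congr rfl fun c _ => ?_
    rw [Multiset.coe_mapAddMonoidHom, Multiset.map_map]
    rfl
  refine ⟨∑ c : {c // B.maxGenEigenspace c ≠ ⊥}, (S c).map (fun a => (a, (c : K))), ?_, ?_, ?_, ?_⟩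
  · exact key A hA Prod.fst hcA
  · exact key B hB Prod.snd hcB
  · exact key (A * B) hABm (fun p => p.1 * p.2) hcAB
  · intro c
    let φ : Multiset (K × K) →+ Multiset (K × K) :=
      { toFun := Multiset.filter (fun p => p.2 = c)
        map_zero' := Multiset.filter_zero _
        map_add' := Multiset.filter_add _ }
    have hφ : ∀ s, Multiset.filter (fun p => p.2 = c) s = φ s := fun _ => rfl
    rw [hφ, map_sum, ← Multiset.coe_mapAddMonoidHom, map_sum,
      Multiset.prod_sum]
    refine Finset.prod_eq_one fun d _ => ?_
    rw [← hφ, Multiset.coe_mapAddMonoidHom, Multiset.filter_map,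
      Multiset.map_map]
    by_cases hd : (d : K) = c
    · rw [Multiset.filter_eq_self.2 (by simpa using fun _ _ => hd)]
      simp only [Function.comp_def, Multiset.map_id']
      rw [← hdet d]
      exact (Module.End.det_eq_prod_roots_charpoly_of_splits (IsAlgClosed.splits _)).symm
    · rw [Multiset.filter_eq_nil.2 (by simpa using fun _ _ => hd)]
      simp

theorem fp_torsion {m : ℕ} (σ : Equiv.Perm (Fin m)) (r : Fin m → Fin m)
    (R : Submodule ℤ (Fin m → ℤ))
    (h1 : ∀ i j, r i = r j → (Pi.single i 1 - Pi.single j 1 : Fin m → ℤ) ∈ R)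
    (h2 : ∀ c, ∑ j ∈ Finset.univ.filter (fun j => r j = c),
      (Pi.single (σ j) 1 - Pi.single j 1 : Fin m → ℤ) ∈ R) (j : Fin m) :
    ∃ N : ℕ, 0 < N ∧ N • (Pi.single (σ j) 1 - Pi.single j 1 : Fin m → ℤ) ∈ R := by
  have key : ∀ ℓ : (Fin m → ℤ) →ₗ[ℤ] ℤ, (∀ x ∈ R, ℓ x = 0) →
      ∀ j, ℓ (Pi.single (σ j) 1 - Pi.single j 1) = 0 := by
    intro ℓ hℓ
    let β : Fin m → ℤ := fun i => ℓ (Pi.single i 1)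
    have hβ : ∀ i j, r i = r j → β i = β j := fun i j hij => by
      have := hℓ _ (h1 i j hij)
      rw [map_sub] at this
      exact sub_eq_zero.1 this
    have hs : ∀ c, ∑ j ∈ Finset.univ.filter (fun j => r j = c), (β (σ j) - β j) = 0 := fun c => by
      have := hℓ _ (h2 c)
      simpa only [map_sum, map_sub] using this
    have h3 : ∑ j, (β (σ j) - β j) * β j = 0 := by
      rw [← Finset.sum_fiberwise (g := r)]
      refine Finset.sum_eq_zero fun c _ => ?_
      by_cases hc : ∃ j0, r j0 = c
      · obtain ⟨j0, rfl⟩ := hc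
        have : ∀ j ∈ Finset.univ.filter (fun j => r j = r j0),
            (β (σ j) - β j) * β j = (β (σ j) - β j) * β j0 := fun j hj => by
          rw [hβ j j0 (by simpa using hj)]
        rw [Finset.sum_congr rfl this, ← Finset.sum_mul, hs, zero_mul]
      · refine Finset.sum_eq_zero fun j hj => absurd ⟨j, by simpa using hj⟩ hc
    have h4 : ∑ j, β (σ j) ^ 2 = ∑ j, β j ^ 2 := Equiv.sum_comp σ (fun j => β j ^ 2)
    have h5 : ∑ j, (β (σ j) - β j) ^ 2 = 0 := by
      have : ∀ j, (β (σ j) - β j) ^ 2 = β (σ j) ^ 2 - β j ^ 2 - 2 * ((β (σ j) - β j) * β j) :=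
        fun j => by ring
      simp_rw [this, Finset.sum_sub_distrib, ← Finset.mul_sum, h3, h4]; simp
    intro j
    rw [map_sub]
    have := (Finset.sum_eq_zero_iff_of_nonneg (fun j _ => sq_nonneg _)).1 h5 j (Finset.mem_univ _)
    exact pow_eq_zero_iff (two_ne_zero) |>.1 this
  let Q := (Fin m → ℤ) ⧸ R
  let T := Q ⧸ Submodule.torsion ℤ Q
  let π : (Fin m → ℤ) →ₗ[ℤ] T := (Submodule.torsion ℤ Q).mkQ ∘ₗ R.mkQ
  have hπ : π (Pi.single (σ j) 1 - Pi.single j 1) = 0 := by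
    refine (Module.forall_dual_apply_eq_zero_iff ℤ _).1 fun ℓ => ?_
    refine key (ℓ ∘ₗ π) (fun x hx => ?_) j
    have : R.mkQ x = 0 := by simpa using hx
    simp only [π, LinearMap.comp_apply, this, map_zero]
  have hmem : R.mkQ (Pi.single (σ j) 1 - Pi.single j 1) ∈ Submodule.torsion ℤ Q := by
    rw [← Submodule.Quotient.mk_eq_zero]
    exact hπ
  obtain ⟨⟨a, ha⟩, h⟩ := hmem
  have ha0 : a ≠ 0 := nonZeroDivisors.ne_zero ha
  have h' : a • (Pi.single (σ j) 1 - Pi.single j 1 : Fin m → ℤ) ∈ R := by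
    rw [← Submodule.Quotient.mk_eq_zero, Submodule.Quotient.mk_smul]
    exact h
  refine ⟨a.natAbs, Int.natAbs_pos.2 ha0, ?_⟩
  rw [← natCast_zsmul]
  rcases Int.natAbs_eq a with h0 | h0
  · rwa [← h0]
  · have : ((a.natAbs : ℤ)) = -a := by omega
    rw [this, neg_smul]; exact R.neg_mem h'

theorem fp_comb (Γ : Type*) [CommGroup Γ] {m : ℕ} (σ : Equiv.Perm (Fin m)) (r : Fin m → Fin m) :
    ∃ N : ℕ, 0 < N ∧ ∀ a b : Fin m → Γ, (∀ i j, r i = r j → b i = b j) →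
      (∀ j, b (σ j) = a j * b j) →
      (∀ c, ∏ j ∈ Finset.univ.filter (fun j => r j = c), a j = 1) → ∀ j, a j ^ N = 1 := by
  let R : Submodule ℤ (Fin m → ℤ) := Submodule.span ℤ
    ({x | ∃ i j, r i = r j ∧ x = Pi.single i 1 - Pi.single j 1} ∪
     {x | ∃ c, x = ∑ j ∈ Finset.univ.filter (fun j => r j = c),
      (Pi.single (σ j) 1 - Pi.single j 1 : Fin m → ℤ)})
  have h := fp_torsion σ r R
    (fun i j h => Submodule.subset_span (Or.inl ⟨i, j, h, rfl⟩))
    (fun c => Submodule.subset_span (Or.inr ⟨c, rfl⟩))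
  choose N hN hNR using h
  refine ⟨∏ j, N j, Finset.prod_pos fun j _ => hN j, ?_⟩
  intro a b hb hab hprod j
  let φ : (Fin m → ℤ) →ₗ[ℤ] Additive Γ :=
    Fintype.linearCombination ℤ (fun i => Additive.ofMul (b i))
  have hφ : ∀ i, φ (Pi.single i 1) = Additive.ofMul (b i) := fun i => by
    simp [φ, Fintype.linearCombination_apply_single]
  have hφa : ∀ j, φ (Pi.single (σ j) 1 - Pi.single j 1) = Additive.ofMul (a j) := fun j => by
    rw [map_sub, hφ, hφ, hab, ← ofMul_div]; simp
  have hR : R ≤ LinearMap.ker φ := by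
    refine Submodule.span_le.2 ?_
    rintro x (⟨i, j, hij, rfl⟩ | ⟨c, rfl⟩)
    · simp [map_sub, hφ, hb i j hij]
    · simp only [SetLike.mem_coe, LinearMap.mem_ker, map_sum, hφa]
      rw [← ofMul_prod, hprod, ofMul_one]
  have h1 : a j ^ N j = 1 := by
    have := hR (hNR j)
    rw [LinearMap.mem_ker, map_nsmul, hφa, ← ofMul_pow] at this
    exact this
  obtain ⟨k, hk⟩ := Finset.dvd_prod_of_mem N (Finset.mem_univ j)
  rw [hk, pow_mul, h1, one_pow]

theorem fp_exists_perm {ι α : Type*} [Fintype ι] (u v : ι → α)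
    (h : Finset.univ.val.map u = Finset.univ.val.map v) :
    ∃ σ : Equiv.Perm ι, ∀ j, u (σ j) = v j := by
  classical
  have hc : ∀ y, Nonempty ({x // v x = y} ≃ {x // u x = y}) := fun y => by
    refine Fintype.card_eq.1 ?_
    have := congrArg (Multiset.count y) h
    rw [Multiset.count_map, Multiset.count_map] at this
    rw [Fintype.card_subtype, Fintype.card_subtype]
    simp only [eq_comm (b := y)]
    exact this.symm
  let e : ∀ y, ({x // v x = y} ≃ {x // u x = y}) := fun y => (hc y).some
  refine ⟨((Equiv.sigmaFiberEquiv v).symm.trans (Equiv.sigmaCongrRight e)).trans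
    (Equiv.sigmaFiberEquiv u), fun j => ?_⟩
  exact (e (v j) ⟨j, rfl⟩).2

open Classical in
theorem fp_bound (Γ : Type*) [CommGroup Γ] (m : ℕ) :
    ∃ N : ℕ, 0 < N ∧ ∀ P : Multiset (Γ × Γ), P.card = m →
      P.map Prod.snd = P.map (fun p => p.1 * p.2) →
      (∀ c, ((P.filter (fun p => p.2 = c)).map Prod.fst).prod = 1) → ∀ p ∈ P, p.1 ^ N = 1 := by
  choose N hN hNR using fun q : Equiv.Perm (Fin m) × (Fin m → Fin m) => fp_comb Γ q.1 q.2
  refine ⟨∏ q, N q, Finset.prod_pos fun j _ => hN j, ?_⟩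
  intro P hP h1 h2 p hp
  obtain ⟨f, rfl⟩ : ∃ f : Fin m → Γ × Γ, P = Finset.univ.val.map f := by
    subst hP
    refine ⟨fun i => P.toList.get (i.cast (by simp)), ?_⟩
    rw [Fin.univ_val_map]
    conv_lhs => rw [← Multiset.coe_toList P, ← List.ofFn_get P.toList]
    congr 1
    refine List.ofFn_congr (by simp) _
  obtain ⟨σ, hσ⟩ : ∃ σ : Equiv.Perm (Fin m), ∀ j, (f (σ j)).2 = (f j).1 * (f j).2 := by
    rw [Multiset.map_map, Multiset.map_map] at h1
    exact fp_exists_perm _ _ h1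
  let r : Fin m → Fin m := fun j => Set.rangeSplitting (fun i => (f i).2) ⟨(f j).2, j, rfl⟩
  have hr : ∀ j, (f (r j)).2 = (f j).2 := fun j =>
    Set.apply_rangeSplitting (fun i => (f i).2) ⟨(f j).2, j, rfl⟩
  have hr2 : ∀ i j, (f i).2 = (f j).2 → r i = r j := fun i j h => by
    simp only [r, h]
  have key := hNR (σ, r) (fun i => (f i).1) (fun i => (f i).2)
    (fun i j h => by
      have h' : r i = r j := h
      rw [← hr i, ← hr j, h']) hσ ?_
  · obtain ⟨j, -, rfl⟩ := Multiset.mem_map.1 hp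
    obtain ⟨k, hk⟩ := Finset.dvd_prod_of_mem N (Finset.mem_univ (σ, r))
    rw [hk, pow_mul, key j, one_pow]
  · intro c
    by_cases hc : ∃ j0, r j0 = c
    · obtain ⟨j0, rfl⟩ := hc
      have := h2 (f j0).2
      rw [Multiset.filter_map, Multiset.map_map] at this
      rw [← this]
      have e : Finset.univ.filter (fun j => r j = r j0) =
        Finset.univ.filter (fun j => (f j).2 = (f j0).2) := by
        ext j
        simp only [Finset.mem_filter, Finset.mem_univ, true_and]
        exact ⟨fun h => by rw [← hr j, h, hr], hr2 _ _⟩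
      dsimp only
      rw [e]
      rfl
    · rw [Finset.filter_false_of_mem, Finset.prod_empty]
      intro j _ hj
      exact hc ⟨j, hj⟩

theorem fp_root_ne_zero {K V : Type*} [Field K] [AddCommGroup V] [Module K V]
    [FiniteDimensional K V] {f : End K V} (hf : IsUnit f) {a : K} (ha : a ∈ f.charpoly.roots) :
    a ≠ 0 := by
  rintro rfl
  have h := (Polynomial.mem_roots f.charpoly_monic.ne_zero).1 ha
  rw [Polynomial.IsRoot, LinearMap.eval_charpoly, map_zero, zero_sub] at h
  have := (LinearMap.isUnit_iff_isUnit_det _).1 hf.neg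
  rw [h] at this
  exact not_isUnit_zero this

theorem fp_quasi {K V G : Type*} [Field K] [IsAlgClosed K] [AddCommGroup V] [Module K V]
    [FiniteDimensional K V] [Group G] (A : G →* End K V)
    (hB : ∀ g, ∃ B : End K V, IsUnit B ∧ (∀ h, Commute B (A h)) ∧
      (A g * B).charpoly = B.charpoly) :
    ∃ N : ℕ, 0 < N ∧ ∀ g ∈ commutator G, (∀ a ∈ (A g).charpoly.roots, a ^ N = 1) := by
  classical
  obtain ⟨N, hN, hNP⟩ := fp_bound Kˣ (finrank K V)
  refine ⟨N, hN, fun g hg => ?_⟩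
  obtain ⟨B, hBu, hBc, hBch⟩ := hB g
  have hdet : ∀ c, ((A g).restrict (B.mapsTo_maxGenEigenspace_of_comm (hBc g) c)).det = 1 := by
    intro c
    let D : G →* K :=
      { toFun := fun h => ((A h).restrict (B.mapsTo_maxGenEigenspace_of_comm (hBc h) c)).det
        map_one' := by
          rw [← LinearMap.det_id (M := B.maxGenEigenspace c)]
          congr 1
          ext v
          simp
        map_mul' := fun x y => by
          rw [← LinearMap.det_comp]
          congr 1
          ext v
          simp only [LinearMap.coe_restrict_apply, map_mul, Module.End.mul_apply]
          rfl }
    have h1 : g ∈ (D.toHomUnits).ker := Abelianization.commutator_subset_ker _ hg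
    have h2 := congrArg Units.val (MonoidHom.mem_ker.1 h1)
    exact h2
  obtain ⟨P, hP1, hP2, hP3, hP4⟩ := fp_joint (A g) B (hBc g) hdet
  have hAu : IsUnit (A g) := (Group.isUnit g).map A
  have hp1 : ∀ p ∈ P, p.1 ≠ 0 := fun p hp => fp_root_ne_zero hAu (by
    rw [hP1]; exact Multiset.mem_map_of_mem _ hp)
  have hp2 : ∀ p ∈ P, p.2 ≠ 0 := fun p hp => fp_root_ne_zero hBu (by
    rw [hP2]; exact Multiset.mem_map_of_mem _ hp)
  let u : K → Kˣ := fun x => if h : x ≠ 0 then Units.mk0 x h else 1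
  have hu : ∀ x, x ≠ 0 → (u x : K) = x := fun x hx => by simp [u, hx]
  let P' : Multiset (Kˣ × Kˣ) := P.map (fun p => (u p.1, u p.2))
  have hinj : Function.Injective (Units.val : Kˣ → K) := Units.val_injective
  have hcard : P'.card = finrank K V := by
    rw [Multiset.card_map, ← (A g).charpoly_natDegree,
      (IsAlgClosed.splits _).natDegree_eq_card_roots, hP1, Multiset.card_map]
  have key := hNP P' hcard ?_ ?_
  · intro a ha
    rw [hP1] at ha
    obtain ⟨p, hp, rfl⟩ := Multiset.mem_map.1 ha
    have := congrArg Units.val (key _ (Multiset.mem_map_of_mem _ hp))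
    simpa [hu _ (hp1 p hp)] using this
  · apply Multiset.map_injective hinj
    rw [Multiset.map_map, Multiset.map_map, Multiset.map_map, Multiset.map_map]
    have e1 : P.map (Units.val ∘ Prod.snd ∘ fun p => (u p.1, u p.2)) = P.map Prod.snd :=
      Multiset.map_congr rfl fun p hp => hu _ (hp2 p hp)
    have e2 : P.map (Units.val ∘ (fun p : Kˣ × Kˣ => p.1 * p.2) ∘ fun p => (u p.1, u p.2)) =
        P.map (fun p => p.1 * p.2) :=
      Multiset.map_congr rfl fun p hp => by simp [hu _ (hp2 p hp), hu _ (hp1 p hp)]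
    have e3 := hP3
    rw [hBch, hP2] at e3
    exact e1.trans (e3.trans e2.symm)
  · intro c
    apply hinj
    rw [Units.val_one, ← hP4 c, ← Units.coeHom_apply, map_multiset_prod, Multiset.filter_map,
      Multiset.map_map, Multiset.map_map]
    congr 1
    have e : P.filter ((fun p : Kˣ × Kˣ => p.2 = c) ∘ fun p => (u p.1, u p.2)) =
        P.filter (fun p => p.2 = (c : K)) := by
      refine Multiset.filter_congr fun p hp => ?_
      simp only [Function.comp_apply]
      rw [← hu _ (hp2 p hp), Units.val_inj, hu _ (hp2 p hp)]
    refine (congrArg (Multiset.map _) (Eq.trans (by congr) e)).trans ?_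
    refine Multiset.map_congr rfl fun p hp => ?_
    exact hu _ (hp1 p (Multiset.mem_of_mem_filter hp))

theorem fp_nilp {K V : Type*} [Field K] [IsAlgClosed K] [AddCommGroup V] [Module K V]
    [FiniteDimensional K V] (f : End K V) (N : ℕ) (h : ∀ a ∈ f.charpoly.roots, a ^ N = 1) :
    IsNilpotent (f ^ N - 1) := by
  refine ⟨f.charpoly.roots.card, ?_⟩
  have h1 : f.charpoly ∣ (Polynomial.X ^ N - 1) ^ f.charpoly.roots.card := by
    conv_lhs => rw [(IsAlgClosed.splits f.charpoly).eq_prod_roots_of_monic f.charpoly_monic]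
    rw [← Multiset.prod_replicate, ← Multiset.map_const']
    refine Multiset.prod_dvd_prod_of_dvd _ _ fun a ha => ?_
    rw [Polynomial.dvd_iff_isRoot]
    simp [h a ha]
  obtain ⟨q, hq⟩ := h1
  have := congrArg (Polynomial.aeval f) hq
  rw [map_mul, LinearMap.aeval_self_charpoly, zero_mul] at this
  simpa using this

theorem fp_nil_of_trace {K V : Type*} [Field K] [CharZero K] [AddCommGroup V] [Module K V]
    [FiniteDimensional K V] (x : End K V)
    (h : ∀ q : Polynomial K, LinearMap.trace K V (Polynomial.aeval x q * x) = 0) :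
    IsNilpotent x := by
  obtain ⟨q, hq, hnd⟩ := Polynomial.exists_eq_pow_rootMultiplicity_mul_and_not_dvd
    x.charpoly x.charpoly_monic.ne_zero 0
  set r := Polynomial.rootMultiplicity 0 x.charpoly with hr
  rw [Polynomial.C_0, sub_zero] at hq hnd
  have hco : IsCoprime (Polynomial.X ^ (r + 1)) q :=
    IsCoprime.pow_left ((Polynomial.irreducible_X.coprime_iff_not_dvd).2 hnd)
  obtain ⟨u, v, huv⟩ := hco
  have hz : Polynomial.aeval x (Polynomial.X ^ r * q) = 0 := by
    rw [← hq, LinearMap.aeval_self_charpoly]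
  let e : End K V := Polynomial.aeval x (u * Polynomial.X ^ (r + 1))
  have he : e = 1 - Polynomial.aeval x (v * q) := by
    rw [eq_sub_iff_add_eq, ← map_add, huv, map_one]
  have h0 : e * Polynomial.aeval x (v * q) = 0 := by
    rw [← map_mul]
    have : u * Polynomial.X ^ (r + 1) * (v * q) =
      (u * v * Polynomial.X) * (Polynomial.X ^ r * q) := by ring
    rw [this, map_mul, hz, mul_zero]
  have hid : IsIdempotentElem e := by
    have : e * e = e * (1 - Polynomial.aeval x (v * q)) := by rw [← he]
    rw [IsIdempotentElem, this, mul_sub, h0, mul_one, sub_zero]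
  have htr : LinearMap.trace K V e = 0 := by
    have h3 := h (u * Polynomial.X ^ r)
    have h4 : Polynomial.aeval x (u * Polynomial.X ^ r) * x = e := by
      have h5 : u * Polynomial.X ^ (r + 1) = u * Polynomial.X ^ r * Polynomial.X := by ring
      change _ = Polynomial.aeval x (u * Polynomial.X ^ (r + 1))
      rw [h5, map_mul (Polynomial.aeval x) (u * Polynomial.X ^ r), Polynomial.aeval_X]
    rw [h4] at h3
    exact h3
  have he0 : e = 0 := (LinearMap.IsIdempotentElem.trace_eq_zero_iff hid).1 htr
  refine ⟨r, ?_⟩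
  rw [he0, eq_comm, sub_eq_zero] at he
  have : x ^ r = x ^ r * Polynomial.aeval x (v * q) := by rw [← he, mul_one]
  rw [this]
  have h2 : x ^ r * Polynomial.aeval x (v * q) =
      Polynomial.aeval x (v * (Polynomial.X ^ r * q)) := by
    have : v * (Polynomial.X ^ r * q) = Polynomial.X ^ r * (v * q) := by ring
    rw [this, map_mul (Polynomial.aeval x) (Polynomial.X ^ r)]; simp
  rw [h2, map_mul, hz, mul_zero]

attribute [local instance] LieRing.ofAssociativeRing

theorem fp_flag {K V : Type*} [Field K] [AddCommGroup V] [Module K V]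
    [FiniteDimensional K V] (L₀ : Submodule K (End K V))
    (hmul : ∀ x ∈ L₀, ∀ y ∈ L₀, x * y ∈ L₀) (hL : ∀ x ∈ L₀, IsNilpotent x) :
    ∃ (F : ℕ → Submodule K V) (k : ℕ), F 0 = ⊤ ∧ F k = ⊥ ∧ (∀ i, F (i + 1) ≤ F i) ∧
      ∀ x ∈ L₀, ∀ i, ∀ v ∈ F i, x v ∈ F (i + 1) := by
  let L : LieSubalgebra K (End K V) :=
    { L₀ with
      lie_mem' := fun {x y} hx hy => by
        rw [LieRing.of_associative_ring_bracket]
        exact L₀.sub_mem (hmul x hx y hy) (hmul y hy x hx) }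
  have hnil : LieModule.IsNilpotent L V := by
    rw [LieModule.isNilpotent_iff_forall (R := K)]
    rintro ⟨x, hx⟩
    exact hL x hx
  obtain ⟨k, hk⟩ := (LieModule.isNilpotent_iff K L V).1 hnil
  refine ⟨fun i => (LieModule.lowerCentralSeries K L V i).toSubmodule, k, ?_, ?_, ?_, ?_⟩
  · simp
  · simp [hk]
  · intro i
    exact LieModule.antitone_lowerCentralSeries K L V (Nat.le_succ i)
  · intro x hx i v hv
    have : ⁅(⟨x, hx⟩ : L), v⁆ ∈ LieModule.lowerCentralSeries K L V (i + 1) := by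
      rw [LieModule.lowerCentralSeries_succ]
      exact LieSubmodule.lie_mem_lie (LieSubmodule.mem_top _) hv
    exact this

theorem fp_const {K V : Type*} [Field K] [CharZero K] [AddCommGroup V] [Module K V]
    (w n : End K V) (hn : IsNilpotent n) (T : Set K) (hT : T.Finite)
    (h : ∀ i : ℕ, LinearMap.trace K V (w * (1 + n) ^ i) ∈ T) :
    LinearMap.trace K V (w * n) = 0 := by
  obtain ⟨d, hd⟩ := hn
  let p : Polynomial K := ∑ k ∈ Finset.range d,
    Polynomial.C (LinearMap.trace K V (w * n ^ k) * ((k.factorial : K))⁻¹) * descPochhammer K k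
  have hp : ∀ i : ℕ, p.eval (i : K) = LinearMap.trace K V (w * (1 + n) ^ i) := by
    intro i
    have h1 : ∀ k, (LinearMap.trace K V (w * n ^ k) * ((k.factorial : K))⁻¹) *
        (descPochhammer K k).eval (i : K) = (i.choose k : K) * LinearMap.trace K V (w * n ^ k) := by
      intro k
      rw [descPochhammer_eval_eq_descFactorial, Nat.descFactorial_eq_factorial_mul_choose]
      have : (k.factorial : K) ≠ 0 := Nat.cast_ne_zero.2 k.factorial_ne_zero
      push_cast
      field_simp
    have h2 : p.eval (i : K) =
        ∑ k ∈ Finset.range d, (i.choose k : K) * LinearMap.trace K V (w * n ^ k) := by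
      simp only [p, Polynomial.eval_finsetSum, Polynomial.eval_mul, Polynomial.eval_C, h1]
    have h3 : LinearMap.trace K V (w * (1 + n) ^ i) =
        ∑ k ∈ Finset.range (i + 1), (i.choose k : K) * LinearMap.trace K V (w * n ^ k) := by
      rw [add_comm, (Commute.one_right n).add_pow, Finset.mul_sum, map_sum]
      refine Finset.sum_congr rfl fun k _ => ?_
      rw [one_pow, mul_one, ← mul_assoc, ← nsmul_eq_mul', map_nsmul, nsmul_eq_mul]
    rw [h2, h3]
    have h4 : ∀ j, d ≤ j → n ^ j = 0 := fun j hj => pow_eq_zero_of_le hj hd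
    rcases le_total d (i + 1) with hle | hle
    · refine Finset.sum_subset (Finset.range_mono hle) fun k _ hk => ?_
      rw [h4 k (by simpa using hk)]; simp
    · refine (Finset.sum_subset (Finset.range_mono hle) fun k _ hk => ?_).symm
      rw [Nat.choose_eq_zero_of_lt (by simpa using hk)]; simp
  have hinf : ∃ t ∈ T, (p - Polynomial.C t) = 0 := by
    by_contra! hcon
    have : (Set.univ : Set ℕ) ⊆ ⋃ t ∈ T, {i : ℕ | (p - Polynomial.C t).eval (i : K) = 0} := by
      intro i _
      simp only [Set.mem_iUnion]
      exact ⟨_, h i, by simp [hp]⟩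
    refine Set.infinite_univ ((hT.biUnion fun t ht => ?_).subset this)
    have hr : {x | (p - Polynomial.C t).IsRoot x}.Finite :=
      Polynomial.finite_setOfPred_isRoot (hcon t ht)
    exact hr.preimage (Nat.cast_injective.injOn)
  obtain ⟨t, -, ht⟩ := hinf
  have e0 := hp 0
  have e1 := hp 1
  rw [sub_eq_zero.1 ht] at e0 e1
  simp only [Polynomial.eval_C, pow_zero, pow_one, mul_one, mul_add, map_add] at e0 e1
  rw [← e0] at e1
  simpa using e1.symm

/-- Iterated (Engel) commutators. -/
def fpEng {G : Type*} [Group G] (x y : G) : ℕ → G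
  | 0 => x
  | k + 1 => fpEng x y k * y * (fpEng x y k)⁻¹ * y⁻¹

theorem fpEng_map {G H : Type*} [Group G] [Group H] (f : G →* H) (x y : G) (k : ℕ) :
    f (fpEng x y k) = fpEng (f x) (f y) k := by
  induction k with
  | zero => rfl
  | succ k ih => simp [fpEng, ih]

theorem fp_trace_finite {K V : Type*} [Field K] [IsAlgClosed K] [AddCommGroup V] [Module K V]
    [FiniteDimensional K V] (N : ℕ) (hN : 0 < N) :
    ∃ T : Set K, T.Finite ∧ ∀ f : End K V, (∀ a ∈ f.charpoly.roots, a ^ N = 1) →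
      LinearMap.trace K V f ∈ T := by
  classical
  let t : Multiset K := (finrank K V) • Polynomial.nthRoots N (1 : K)
  refine ⟨(t.powerset.toFinset.image Multiset.sum : Finset K), Finset.finite_toSet _, ?_⟩
  intro f hf
  simp only [Finset.coe_image, Set.mem_image, Finset.mem_coe, Multiset.mem_toFinset,
    Multiset.mem_powerset]
  refine ⟨f.charpoly.roots, ?_,
    (Module.End.trace_eq_sum_roots_charpoly_of_splits (IsAlgClosed.splits _)).symm⟩
  rw [Multiset.le_iff_count]
  intro a
  by_cases ha : a ∈ f.charpoly.roots
  · have h1 : a ∈ Polynomial.nthRoots N (1 : K) := (Polynomial.mem_nthRoots hN).2 (hf a ha)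
    have h2 := Multiset.one_le_count_iff_mem.2 h1
    have h3 : f.charpoly.roots.count a ≤ finrank K V := by
      refine (Multiset.count_le_card _ _).trans ?_
      rw [← f.charpoly_natDegree]
      exact Polynomial.card_roots' _
    rw [Multiset.count_nsmul]
    nlinarith
  · rw [Multiset.count_eq_zero_of_notMem ha]; exact Nat.zero_le _

theorem fp_engel_zero {K V G : Type*} [Field K] [IsAlgClosed K] [CharZero K] [AddCommGroup V]
    [Module K V] [FiniteDimensional K V] [Group G] (A : G →* End K V) (N : ℕ) (hN : 0 < N)
    (h : ∀ g, ∀ a ∈ (A g).charpoly.roots, a ^ N = 1) :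
    ∃ k, ∀ x y : G, A (fpEng (x ^ N) (y ^ N) k) = 1 := by
  obtain ⟨T, hT, hTr⟩ := fp_trace_finite (K := K) (V := V) N hN
  let E : Submodule K (End K V) := Submodule.span K (Set.range A)
  have hAE : ∀ g, A g ∈ E := fun g => Submodule.subset_span ⟨g, rfl⟩
  have hEmul : ∀ x ∈ E, ∀ y ∈ E, x * y ∈ E := by
    intro x hx y hy
    have h1 := Submodule.mul_mem_mul hx hy
    rw [Submodule.span_mul_span] at h1
    refine Submodule.span_mono ?_ h1
    rintro _ ⟨_, ⟨a, rfl⟩, _, ⟨b, rfl⟩, rfl⟩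
    exact ⟨a * b, map_mul _ _ _⟩
  have hE1 : (1 : End K V) ∈ E := by simpa using hAE 1
  have hEpow : ∀ x ∈ E, ∀ k : ℕ, x ^ k ∈ E := by
    intro x hx k
    induction k with
    | zero => simpa using hE1
    | succ k ih => rw [pow_succ]; exact hEmul _ ih _ hx
  have hEaeval : ∀ x ∈ E, ∀ q : Polynomial K, Polynomial.aeval x q ∈ E := by
    intro x hx q
    rw [Polynomial.aeval_eq_sum_range]
    exact E.sum_mem fun i _ => E.smul_mem _ (hEpow x hx i)
  let L : Submodule K (End K V) :=
    { carrier := {x | x ∈ E ∧ ∀ e ∈ E, LinearMap.trace K V (e * x) = 0}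
      zero_mem' := ⟨E.zero_mem, by simp⟩
      add_mem' := fun {a b} ha hb => ⟨E.add_mem ha.1 hb.1, fun e he => by
        rw [mul_add, map_add, ha.2 e he, hb.2 e he, add_zero]⟩
      smul_mem' := fun c a ha => ⟨E.smul_mem c ha.1, fun e he => by
        rw [mul_smul_comm, map_smul, ha.2 e he, smul_zero]⟩ }
  have hLl : ∀ e ∈ E, ∀ x ∈ L, e * x ∈ L := fun e he x hx =>
    ⟨hEmul e he x hx.1, fun e' he' => by rw [← mul_assoc]; exact hx.2 _ (hEmul _ he' _ he)⟩
  have hLnil : ∀ x ∈ L, IsNilpotent x := fun x hx =>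
    fp_nil_of_trace x fun q => hx.2 _ (hEaeval x hx.1 q)
  obtain ⟨F, k, hF0, hFk, hanti, hF⟩ := fp_flag L (fun x hx y hy => hLl x hx.1 y hy) hLnil
  have hpow : ∀ g, A (g ^ N) - 1 ∈ L := by
    intro g
    have hn : IsNilpotent (A (g ^ N) - 1) := by
      rw [map_pow]; exact fp_nilp (A g) N (h g)
    refine ⟨E.sub_mem (hAE _) hE1, fun e he => ?_⟩
    induction he using Submodule.span_induction with
    | mem w hw =>
      obtain ⟨w, rfl⟩ := hw
      refine fp_const (A w) _ hn T hT fun i => ?_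
      rw [add_sub_cancel, ← map_pow, ← map_mul]
      exact hTr _ (h _)
    | zero => simp
    | add a b _ _ ha hb => rw [add_mul, map_add, ha, hb, add_zero]
    | smul c a _ ha => rw [smul_mul_assoc, map_smul, ha, smul_zero]
  let U : Subgroup G :=
    { carrier := {g | A g - 1 ∈ L}
      one_mem' := by simp
      mul_mem' := fun {a b} ha hb => by
        have : A (a * b) - 1 = A a * (A b - 1) + (A a - 1) := by
          rw [map_mul, mul_sub, mul_one]; abel
        change A (a * b) - 1 ∈ L
        rw [this]
        exact L.add_mem (hLl _ (hAE a) _ hb) ha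
      inv_mem' := fun {a} ha => by
        have : A a⁻¹ - 1 = -(A a⁻¹ * (A a - 1)) := by
          rw [mul_sub, mul_one, ← map_mul, inv_mul_cancel, map_one]; abel
        change A a⁻¹ - 1 ∈ L
        rw [this]
        exact L.neg_mem (hLl _ (hAE _) _ ha) }
  have hUF : ∀ g ∈ U, ∀ i, ∀ v ∈ F i, A g v ∈ F i := by
    intro g hg i v hv
    have h1 := hanti i (hF _ hg i v hv)
    have h2 := (F i).add_mem h1 hv
    simpa using h2
  refine ⟨k, fun x y => ?_⟩
  have hxU : x ^ N ∈ U := hpow x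
  have hyU : y ^ N ∈ U := hpow y
  have hcU : ∀ j, fpEng (x ^ N) (y ^ N) j ∈ U := by
    intro j
    induction j with
    | zero => exact hxU
    | succ j ih => exact U.mul_mem (U.mul_mem (U.mul_mem ih hyU) (U.inv_mem ih)) (U.inv_mem hyU)
  have main : ∀ j, ∀ i, ∀ v ∈ F i, (A (fpEng (x ^ N) (y ^ N) j) - 1) v ∈ F (i + j + 1) := by
    intro j
    induction j with
    | zero => exact fun i v hv => hF _ hxU i v hv
    | succ j ih =>
      intro i v hv
      set c := fpEng (x ^ N) (y ^ N) j with hc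
      set z := y ^ N with hz
      have hcU' : c ∈ U := hcU j
      have e1 : A (fpEng (x ^ N) z (j + 1)) - 1 =
          ((A c - 1) * (A z - 1) - (A z - 1) * (A c - 1)) * A (c⁻¹ * z⁻¹) := by
        have e2 : (A c - 1) * (A z - 1) - (A z - 1) * (A c - 1) = A (c * z) - A (z * c) := by
          rw [map_mul, map_mul]; noncomm_ring
        rw [e2, sub_mul, ← map_mul, ← map_mul]
        have e3 : z * c * (c⁻¹ * z⁻¹) = 1 := by group
        have e4 : c * z * (c⁻¹ * z⁻¹) = fpEng (x ^ N) z (j + 1) := by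
          simp only [fpEng, ← hc, mul_assoc]
        rw [e3, e4, map_one]
      rw [e1]
      have hv' := hUF _ (U.mul_mem (U.inv_mem hcU') (U.inv_mem hyU)) i v hv
      set v' := A (c⁻¹ * z⁻¹) v
      have p1 := ih (i + 1) _ (hF _ hyU i v' hv')
      have p2 := hF _ hyU _ _ (ih i v' hv')
      have q : i + 1 + j + 1 = i + (j + 1) + 1 := by ring
      have q2 : i + j + 1 + 1 = i + (j + 1) + 1 := by ring
      rw [q] at p1
      rw [q2] at p2
      exact (F _).sub_mem p1 p2
  have hbot : ∀ j, F (k + j) = ⊥ := by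
    intro j
    induction j with
    | zero => exact hFk
    | succ j ih => exact le_bot_iff.1 ((hanti (k + j)).trans ih.le)
  refine LinearMap.ext fun v => ?_
  have := main k 0 v (by rw [hF0]; trivial)
  rw [zero_add, hbot 1] at this
  have h3 := (Submodule.mem_bot K).1 this
  simpa [sub_eq_zero] using h3

theorem fp_engel {K V G : Type*} [Field K] [IsAlgClosed K] [AddCommGroup V]
    [Module K V] [FiniteDimensional K V] [Group G] (A : G →* End K V) (N : ℕ) (hN : 0 < N)
    (h : ∀ g, ∀ a ∈ (A g).charpoly.roots, a ^ N = 1) :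
    ∃ M k, 0 < M ∧ ∀ x y : G, A (fpEng (x ^ M) (y ^ M) k) = 1 := by
  obtain ⟨p, hp⟩ := CharP.exists K
  rcases CharP.char_is_prime_or_zero K p with hpp | rfl
  · rcases subsingleton_or_nontrivial V with hV | hV
    · exact ⟨1, 0, one_pos, fun x y => Subsingleton.elim _ _⟩
    have : Fact p.Prime := ⟨hpp⟩
    have : CharP (End K V) p :=
      charP_of_injective_algebraMap (algebraMap K (End K V)).injective p
    refine ⟨N * p ^ (finrank K V), 0, Nat.mul_pos hN (pow_pos hpp.pos _), fun x y => ?_⟩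
    have hn := fp_nilp (A x) N (h x)
    have h1 := hn.charpoly_eq_X_pow_finrank
    have h2 := LinearMap.aeval_self_charpoly (A x ^ N - 1)
    rw [h1, map_pow, Polynomial.aeval_X] at h2
    have h3 : (A x ^ N - 1) ^ (p ^ finrank K V) = 0 :=
      pow_eq_zero_of_le (Nat.lt_pow_self hpp.one_lt).le h2
    rw [sub_pow_char_pow_of_commute _ _ (Commute.one_right _), one_pow, sub_eq_zero] at h3
    change A (x ^ _) = 1
    rw [map_pow, pow_mul, h3]
  · have : CharZero K := CharP.charP_to_charZero K
    obtain ⟨k, hk⟩ := fp_engel_zero A N hN h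
    exact ⟨N, k, hN, hk⟩

/-- The upper triangular invertible matrix with rows `(a, t)` and `(0, d)`. -/
def fpUp (a d : ℚˣ) (t : ℚ) : Matrix.GeneralLinearGroup (Fin 2) ℚ where
  val := !![(a : ℚ), t; 0, (d : ℚ)]
  inv := !![((a⁻¹ : ℚˣ) : ℚ), -((a⁻¹ : ℚˣ) : ℚ) * t * ((d⁻¹ : ℚˣ) : ℚ); 0, ((d⁻¹ : ℚˣ) : ℚ)]
  val_inv := by
    have ha := a.ne_zero
    ext i j; fin_cases i <;> fin_cases j <;> simp [Matrix.mul_apply]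
    field_simp
    ring
  inv_val := by
    ext i j; fin_cases i <;> fin_cases j <;> simp [Matrix.mul_apply]

theorem fpUp_mul (a d a' d' : ℚˣ) (t t' : ℚ) :
    fpUp a d t * fpUp a' d' t' = fpUp (a * a') (d * d') (a * t' + t * d') := by
  ext i j
  fin_cases i <;> fin_cases j <;> simp [fpUp, Matrix.mul_apply]

theorem fpUp_inj {a d a' d' : ℚˣ} {t t' : ℚ} (h : fpUp a d t = fpUp a' d' t') : t = t' := by
  have := congrArg (fun M : Matrix.GeneralLinearGroup (Fin 2) ℚ => (M : Matrix (Fin 2) (Fin 2) ℚ) 0 1) h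
  simpa [fpUp] using this

theorem fpUp_one : fpUp 1 1 0 = 1 := by
  ext i j
  fin_cases i <;> fin_cases j <;> simp [fpUp]

theorem fpUp_inv (a d : ℚˣ) (t : ℚ) :
    (fpUp a d t)⁻¹ = fpUp a⁻¹ d⁻¹ (-((a⁻¹ : ℚˣ) : ℚ) * t * ((d⁻¹ : ℚˣ) : ℚ)) := by
  rw [inv_eq_iff_mul_eq_one, fpUp_mul, ← fpUp_one]
  have ha := a.ne_zero
  congr 1 <;> simp
  field_simp
  ring

theorem fpUp_pow_one (t : ℚ) (k : ℕ) : (fpUp 1 1 t) ^ k = fpUp 1 1 (k * t) := by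
  induction k with
  | zero => simp [fpUp_one]
  | succ k ih =>
    rw [pow_succ, ih, fpUp_mul]
    rw [Units.val_one, Nat.cast_succ, mul_one]
    congr 1
    ring

theorem fpUp_pow (a d : ℚˣ) (t : ℚ) (k : ℕ) : ∃ s, (fpUp a d t) ^ k = fpUp (a ^ k) (d ^ k) s := by
  induction k with
  | zero => exact ⟨0, by simp [fpUp_one]⟩
  | succ k ih =>
    obtain ⟨s, hs⟩ := ih
    rw [pow_succ, hs, fpUp_mul]
    exact ⟨_, by rw [pow_succ, pow_succ]⟩

theorem fpUp_eng (a d : ℚˣ) (t s : ℚ) (k : ℕ) :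
    fpEng (fpUp 1 1 t) (fpUp a d s) k = fpUp 1 1 (t * (1 - a * ((d⁻¹ : ℚˣ) : ℚ)) ^ k) := by
  induction k with
  | zero => simp [fpEng]
  | succ k ih =>
    rw [fpEng, ih, fpUp_inv, fpUp_inv, fpUp_mul, fpUp_mul, fpUp_mul]
    congr 1
    · simp
    · simp
    · have hd := d.ne_zero
      rw [pow_succ]
      generalize (1 - (a : ℚ) * ((d⁻¹ : ℚˣ) : ℚ)) ^ k = q
      have ha := a.ne_zero
      simp
      field_simp
      ring

/-- The unit 2 of the rationals. -/
def fpTwo : ℚˣ := Units.mk0 2 (by norm_num)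

/-- A noncentral matrix used for the test representation. -/
def fpB : Matrix.GeneralLinearGroup (Fin 2) ℚ where
  val := !![1, 1; 1, 0]
  inv := !![0, 1; 1, -1]
  val_inv := by ext i j; fin_cases i <;> fin_cases j <;> simp [Matrix.mul_apply]
  inv_val := by ext i j; fin_cases i <;> fin_cases j <;> simp [Matrix.mul_apply]

theorem fp_comm1 : fpUp fpTwo 1 0 * fpB * (fpUp fpTwo 1 0)⁻¹ * fpB⁻¹ = fpUp fpTwo fpTwo⁻¹ (-1) := by
  rw [mul_inv_eq_iff_eq_mul, mul_inv_eq_iff_eq_mul]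
  ext i j
  fin_cases i <;> fin_cases j <;>
    simp [fpUp, fpB, Matrix.mul_apply, fpTwo]
  norm_num

theorem fp_comm2 : fpUp fpTwo fpTwo⁻¹ (-1) * fpUp fpTwo 1 0 * (fpUp fpTwo fpTwo⁻¹ (-1))⁻¹ *
    (fpUp fpTwo 1 0)⁻¹ = fpUp 1 1 2 := by
  rw [mul_inv_eq_iff_eq_mul, mul_inv_eq_iff_eq_mul]
  ext i j
  fin_cases i <;> fin_cases j <;>
    simp [fpUp, Matrix.mul_apply, fpTwo]
  norm_num

theorem fp_test (M k : ℕ) (hM : 0 < M) :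
    ¬ Commute (fpUp fpTwo 1 0) (fpEng (fpUp 1 1 2 ^ M) (fpUp fpTwo fpTwo⁻¹ (-1) ^ M) k) := by
  intro h
  obtain ⟨s, hs⟩ := fpUp_pow fpTwo fpTwo⁻¹ (-1) M
  rw [hs, fpUp_pow_one, fpUp_eng] at h
  have h1 := h.eq
  rw [fpUp_mul, fpUp_mul] at h1
  have h2 := fpUp_inj h1
  have h3 : ((M : ℚ) * 2 * (1 - (2:ℚ) ^ M * 2 ^ M) ^ k) = 0 := by
    simp [fpTwo] at h2
    by_contra hne
    have hne' : (M : ℚ) * 2 * (1 - (2:ℚ) ^ M * 2 ^ M) ^ k ≠ 0 := hne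
    grind
  have h4 : (1:ℚ) < 2 ^ M := one_lt_pow₀ (by norm_num) hM.ne'
  have h5 : (1 - (2:ℚ) ^ M * 2 ^ M) ≠ 0 := by nlinarith
  have h6 : (M : ℚ) ≠ 0 := by exact_mod_cast hM.ne'
  exact (mul_ne_zero (mul_ne_zero h6 two_ne_zero) (pow_ne_zero k h5)) h3

/-- The transvection endomorphism sending the generator `c` to `c * u`. -/
def fpPsi {n : ℕ} (c : Fin n) (u : FreeGroup (Fin n)) : FreeGroup (Fin n) →* FreeGroup (Fin n) :=
  FreeGroup.lift (fun i => if i = c then FreeGroup.of c * u else FreeGroup.of i)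

/-- The inclusion of the free group of rank two. -/
def fpJ {n : ℕ} (a b : Fin n) : FreeGroup (Fin 2) →* FreeGroup (Fin n) :=
  FreeGroup.lift (fun i => if i = 0 then FreeGroup.of a else FreeGroup.of b)

theorem fpPsi_J {n : ℕ} (a b c : Fin n) (hac : a ≠ c) (hbc : b ≠ c) (u : FreeGroup (Fin n))
    (g : FreeGroup (Fin 2)) : fpPsi c u (fpJ a b g) = fpJ a b g := by
  have : (fpPsi c u).comp (fpJ a b) = fpJ a b := by
    ext i
    fin_cases i <;> simp [fpPsi, fpJ, hac, hbc]
  exact DFunLike.congr_fun this g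

theorem fpPsi_comp {n : ℕ} (a b c : Fin n) (hac : a ≠ c) (hbc : b ≠ c)
    (g h : FreeGroup (Fin 2)) (hgh : g * h = 1) :
    (fpPsi c (fpJ a b g)).comp (fpPsi c (fpJ a b h)) = MonoidHom.id _ := by
  ext i
  by_cases hi : i = c
  · subst hi
    have h1 : fpPsi i (fpJ a b h) (FreeGroup.of i) = FreeGroup.of i * fpJ a b h := by simp [fpPsi]
    have h2 : fpPsi i (fpJ a b g) (FreeGroup.of i) = FreeGroup.of i * fpJ a b g := by simp [fpPsi]
    rw [MonoidHom.comp_apply, h1, map_mul, h2, fpPsi_J a b i hac hbc, mul_assoc, ← map_mul, hgh]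
    simp
  · simp [fpPsi, hi]

/-- The transvection automorphism. -/
def fpAut {n : ℕ} (a b c : Fin n) (hac : a ≠ c) (hbc : b ≠ c) (g : FreeGroup (Fin 2)) :
    MulAut (FreeGroup (Fin n)) :=
  MonoidHom.toMulEquiv (fpPsi c (fpJ a b g)) (fpPsi c (fpJ a b g⁻¹))
    (fpPsi_comp a b c hac hbc _ _ (by simp)) (fpPsi_comp a b c hac hbc _ _ (by simp))

theorem fpAut_apply {n : ℕ} (a b c : Fin n) (hac : a ≠ c) (hbc : b ≠ c) (g : FreeGroup (Fin 2))
    (w : FreeGroup (Fin n)) : fpAut a b c hac hbc g w = fpPsi c (fpJ a b g) w := rfl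

theorem fpAut_commute {n : ℕ} (a b c : Fin n) (hac : a ≠ c) (hbc : b ≠ c)
    (g h : FreeGroup (Fin 2)) :
    Commute (fpAut a b c hac hbc g) (MulAut.conj (fpJ a b h)) := by
  refine MulEquiv.ext fun w => ?_
  simp only [MulAut.mul_apply, MulAut.conj_apply, map_mul, map_inv, fpAut_apply,
    fpPsi_J a b c hac hbc]

theorem fpAut_conj {n : ℕ} (a b c : Fin n) (hac : a ≠ c) (hbc : b ≠ c)
    (g : FreeGroup (Fin 2)) :
    MulAut.conj (FreeGroup.of c) * (MulAut.conj (fpJ a b g) * fpAut a b c hac hbc g) =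
      fpAut a b c hac hbc g * MulAut.conj (FreeGroup.of c) := by
  refine MulEquiv.ext fun w => ?_
  have h2 : fpPsi c (fpJ a b g) (FreeGroup.of c) = FreeGroup.of c * fpJ a b g := by simp [fpPsi]
  simp only [MulAut.mul_apply, MulAut.conj_apply, map_mul, map_inv, fpAut_apply, h2]
  group

/-- The natural representation of the general linear group. -/
noncomputable def fpL {K : Type*} [Field K] (m : ℕ) :
    Matrix.GeneralLinearGroup (Fin m) K →* End K (Fin m → K) :=
  ((Matrix.toLinAlgEquiv' : Matrix (Fin m) (Fin m) K ≃ₐ[K] _) :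
    Matrix (Fin m) (Fin m) K →* End K (Fin m → K)).comp (Units.coeHom _)

theorem fpL_apply {K : Type*} [Field K] (m : ℕ) (x : Matrix.GeneralLinearGroup (Fin m) K) :
    fpL m x = Matrix.toLin' (x : Matrix (Fin m) (Fin m) K) := rfl

theorem fpL_inj {K : Type*} [Field K] (m : ℕ) : Function.Injective (fpL (K := K) m) := by
  intro x y hxy
  rw [fpL_apply, fpL_apply] at hxy
  exact Units.ext (Matrix.toLin'.injective hxy)

theorem fp_conj {K : Type*} [Field K] {m : ℕ} (u x y : Matrix.GeneralLinearGroup (Fin m) K)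
    (h : u * x = y * u) : (fpL m x).charpoly = (fpL m y).charpoly := by
  rw [fpL_apply, fpL_apply, Matrix.charpoly_toLin', Matrix.charpoly_toLin']
  have : y = u * x * u⁻¹ := by rw [h]; group
  rw [this, Units.val_mul, Units.val_mul, Matrix.coe_units_inv, Matrix.charpoly_units_conj]

theorem fp_core {n : ℕ} (hn : 3 ≤ n) {K : Type*} [Field K] [IsAlgClosed K] (m : ℕ)
    (ρ : MulAut (FreeGroup (Fin n)) →* Matrix.GeneralLinearGroup (Fin m) K) (hρ : Function.Injective ρ) : False := by
  let a : Fin n := ⟨0, by omega⟩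
  let b : Fin n := ⟨1, by omega⟩
  let c : Fin n := ⟨2, by omega⟩
  have hac : a ≠ c := by simp [a, c]
  have hbc : b ≠ c := by simp [b, c]
  have hab : b ≠ a := by simp [a, b]
  let R := (fpL m).comp ρ
  have hR : Function.Injective R := (fpL_inj m).comp hρ
  let A : FreeGroup (Fin 2) →* End K (Fin m → K) := R.comp (MulAut.conj.comp (fpJ a b))
  obtain ⟨N, hN, hq⟩ := fp_quasi A (fun g => by
    refine ⟨R (fpAut a b c hac hbc g), (Group.isUnit _).map R,
      fun h => (fpAut_commute a b c hac hbc g h).map R, ?_⟩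
    change (R (MulAut.conj (fpJ a b g)) * R (fpAut a b c hac hbc g)).charpoly = _
    rw [← map_mul]
    have h1 := congrArg ρ (fpAut_conj a b c hac hbc g)
    rw [map_mul, map_mul ρ (fpAut a b c hac hbc g)] at h1
    exact fp_conj _ _ _ h1)
  obtain ⟨M, k, hM, hk⟩ := fp_engel (A.comp (commutator (FreeGroup (Fin 2))).subtype) N hN
    (fun g => hq g g.2)
  let x₀ : FreeGroup (Fin 2) := FreeGroup.of 0
  let x₁ : FreeGroup (Fin 2) := FreeGroup.of 1
  let y : FreeGroup (Fin 2) := x₀ * x₁ * x₀⁻¹ * x₁⁻¹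
  have hy : y ∈ commutator (FreeGroup (Fin 2)) :=
    Subgroup.commutator_mem_commutator (Subgroup.mem_top x₀) (Subgroup.mem_top x₁)
  let x : FreeGroup (Fin 2) := y * x₀ * y⁻¹ * x₀⁻¹
  have hx : x ∈ commutator (FreeGroup (Fin 2)) :=
    Subgroup.commutator_mem_commutator (Subgroup.mem_top y) (Subgroup.mem_top x₀)
  have h1 := hk ⟨x, hx⟩ ⟨y, hy⟩
  rw [MonoidHom.comp_apply, fpEng_map, map_pow, map_pow] at h1
  change R (MulAut.conj (fpJ a b (fpEng (x ^ M) (y ^ M) k))) = 1 at h1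
  have h2 := hR (h1.trans (map_one R).symm)
  have h3 : Commute (FreeGroup.of a) (fpJ a b (fpEng (x ^ M) (y ^ M) k)) := by
    have := DFunLike.congr_fun h2 (FreeGroup.of a)
    rw [MulAut.conj_apply, MulAut.one_apply, mul_inv_eq_iff_eq_mul] at this
    exact this.symm
  let π : FreeGroup (Fin n) →* Matrix.GeneralLinearGroup (Fin 2) ℚ :=
    FreeGroup.lift (fun i => if i = a then fpUp fpTwo 1 0 else if i = b then fpB else 1)
  have hπa : π (FreeGroup.of a) = fpUp fpTwo 1 0 := by simp [π]
  have h0 : π (fpJ a b x₀) = fpUp fpTwo 1 0 := by simp [π, fpJ, x₀]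
  have h1' : π (fpJ a b x₁) = fpB := by simp [π, fpJ, x₁, hab]
  have hy' : π (fpJ a b y) = fpUp fpTwo fpTwo⁻¹ (-1) := by
    simp only [y, map_mul, map_inv, h0, h1']
    exact fp_comm1
  have hx' : π (fpJ a b x) = fpUp 1 1 2 := by
    simp only [x, map_mul, map_inv, h0, hy']
    exact fp_comm2
  have h4 := h3.map π
  rw [fpEng_map, fpEng_map, hπa, map_pow, map_pow, map_pow, map_pow, hx', hy'] at h4
  exact fp_test M k hM h4
end

/-- If a group `H` contains `Aut(Fₙ)` with `n ≥ 3`, then `H` is nonlinear. -/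
theorem nonlinear_of_contains_aut (n : ℕ) (hn : 3 ≤ n)
    (H : Type*) [Group H]
    (hH : ∃ f : MulAut (FreeGroup (Fin n)) →* H, Function.Injective f) :
    ∀ (K : Type*) [Field K] (m : ℕ),
      ¬ ∃ φ : H →* Matrix.GeneralLinearGroup (Fin m) K, Function.Injective φ := by
  rintro K _ m ⟨φ, hφ⟩
  obtain ⟨f, hf⟩ := hH
  refine fp_core hn (K := AlgebraicClosure K) m
    (((Matrix.GeneralLinearGroup.map (algebraMap K (AlgebraicClosure K))).comp φ).comp f) ?_
  have hmap : Function.Injective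
      (Matrix.GeneralLinearGroup.map (n := Fin m) (algebraMap K (AlgebraicClosure K))) := by
    intro x y hxy
    ext i j
    have := congrArg (fun M : Matrix.GeneralLinearGroup (Fin m) (AlgebraicClosure K) =>
      (M : Matrix (Fin m) (Fin m) (AlgebraicClosure K)) i j) hxy
    exact (algebraMap K (AlgebraicClosure K)).injective (by simpa using this)
  exact (hmap.comp hφ).comp hf
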